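/- arXiv:2208.05631 — 2 statements merged into one kernel-verified Lean document; each statement's English description precedes it below -/
import Mathlib

section
/- Let f : ℝ^d → ℝ be convex and differentiable with L-Lipschitz gradient (L ≥ 0), let φ : ℝ^d → ℝ be convex, let H be a symmetric d×d matrix with xᵀHx ≥ ‖x‖₂² for all x (in particular H is positive definite), and let η satisfy 0 < η ≤ 1/(1+L). Given x₀ ∈ ℝ^d and q ∈ ℝ^d, let x₊ be the (unique) minimizer over x ∈ ℝ^d of η⟨q, x⟩ + η·φ(x) + (1/2)(x − x₀)ᵀH(x − x₀). Then for every x* ∈ ℝ^d: f(x₊) + φ(x₊) − f(x*) − φ(x*) ≤ ⟨q − ∇f(x₀), x* − x₀⟩ + (1/2)(q − ∇f(x₀))ᵀ H⁻¹ (q − ∇f(x₀)) + (1/η)·[B(x*, x₀) − B(x*, x₊)], where B(x, y) = (1/2)(x − y)ᵀH(x − y). -/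
open Matrix
open scoped RealInnerProductSpace

section

variable {E : Type*} [NormedAddCommGroup E] [InnerProductSpace ℝ E]

theorem HasGradientAt.hasDerivAt_comp_add_smul [CompleteSpace E] {f : E → ℝ} {g x v : E} {t : ℝ}
    (hf : HasGradientAt f g (x + t • v)) :
    HasDerivAt (fun s : ℝ => f (x + s • v)) ⟪g, v⟫ t := by
  have hline : HasDerivAt (fun s : ℝ => x + s • v) v t := by
    simpa using ((hasDerivAt_id t).smul_const v).const_add x
  simpa using! hf.hasFDerivAt.comp_hasDerivAt t hline

theorem ConvexOn.add_inner_gradient_le [CompleteSpace E] {f : E → ℝ} {g x : E}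
    (hf : ConvexOn ℝ Set.univ f) (hg : HasGradientAt f g x) (y : E) :
    f x + ⟪g, y - x⟫ ≤ f y := by
  have hconv : ConvexOn ℝ Set.univ (fun s : ℝ => f (x + s • (y - x))) := by
    simpa [Function.comp_def, AffineMap.lineMap_apply, add_comm] using
      hf.comp_affineMap (AffineMap.lineMap x y : ℝ →ᵃ[ℝ] E)
  have hder : HasDerivAt (fun s : ℝ => f (x + s • (y - x))) ⟪g, y - x⟫ 0 :=
    HasGradientAt.hasDerivAt_comp_add_smul (by simpa using hg)
  have := hconv.le_slope_of_hasDerivAt (Set.mem_univ 0) (Set.mem_univ 1) one_pos hder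
  simp [slope_def_field] at this
  linarith

/-- The descent lemma for functions with Lipschitz gradient. -/
theorem LipschitzWith.le_add_inner_gradient_add_sq [CompleteSpace E] {f : E → ℝ} {gradf : E → E}
    {L : NNReal} (hL : LipschitzWith L gradf) (hf : ∀ x, HasGradientAt f (gradf x) x) (x y : E) :
    f y ≤ f x + ⟪gradf x, y - x⟫ + L / 2 * ‖y - x‖ ^ 2 := by
  set v := y - x with hv
  let h : ℝ → ℝ := fun t => f (x + t • v) - t * ⟪gradf x, v⟫ - t ^ 2 * (L / 2 * ‖v‖ ^ 2)
  have hder (t : ℝ) : HasDerivAt h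
      (⟪gradf (x + t • v), v⟫ - ⟪gradf x, v⟫ - 2 * t * (L / 2 * ‖v‖ ^ 2)) t := by
    simpa using! ((hf (x + t • v)).hasDerivAt_comp_add_smul.sub
      ((hasDerivAt_id t).mul_const ⟪gradf x, v⟫)).sub
        ((hasDerivAt_pow 2 t).mul_const (L / 2 * ‖v‖ ^ 2))
  have hanti : AntitoneOn h (Set.Ici 0) := by
    refine antitoneOn_of_deriv_nonpos (convex_Ici 0)
      (fun t _ => (hder t).continuousAt.continuousWithinAt)
      (fun t _ => (hder t).differentiableAt.differentiableWithinAt) fun t ht => ?_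
    have ht : 0 < t := by simpa using ht
    have hlip : ‖gradf (x + t • v) - gradf x‖ ≤ L * (t * ‖v‖) := by
      simpa [norm_smul, abs_of_pos ht] using hL.norm_sub_le (x + t • v) x
    have hinner : ⟪gradf (x + t • v) - gradf x, v⟫ ≤ L * (t * ‖v‖) * ‖v‖ :=
      (real_inner_le_norm _ _).trans (by gcongr)
    rw [inner_sub_left] at hinner
    rw [(hder t).deriv]
    linarith
  have := hanti (Set.mem_Ici.2 le_rfl) (Set.mem_Ici.2 zero_le_one) zero_le_one
  simp [h, hv] at this
  linarith

/-- Three-point inequality for a minimizer of a convex function plus a quadratic form. -/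
theorem ConvexOn.add_inner_map_le_of_isMinOn {g : E → ℝ} (hg : ConvexOn ℝ Set.univ g)
    {T : E →ₗ[ℝ] E} (hT : T.IsSymmetric) {x₀ p : E}
    (hmin : IsMinOn (fun x => g x + 1 / 2 * ⟪x - x₀, T (x - x₀)⟫) Set.univ p) (z : E) :
    g p + 1 / 2 * ⟪p - x₀, T (p - x₀)⟫ + 1 / 2 * ⟪z - p, T (z - p)⟫
      ≤ g z + 1 / 2 * ⟪z - x₀, T (z - x₀)⟫ := by
  have hsymm : ⟪z - p, T (p - x₀)⟫ = ⟪p - x₀, T (z - p)⟫ := by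
    rw [← hT, real_inner_comm]
  have hstep : ∀ t ∈ Set.Ioo (0 : ℝ) 1,
      0 ≤ g z - g p + ⟪p - x₀, T (z - p)⟫ + t * (1 / 2 * ⟪z - p, T (z - p)⟫) := by
    rintro t ⟨ht0, ht1⟩
    have hle := isMinOn_iff.1 hmin (p + t • (z - p)) (Set.mem_univ _)
    have hconv := hg.2 (Set.mem_univ p) (Set.mem_univ z) (sub_nonneg.2 ht1.le) ht0.le
      (sub_add_cancel 1 t)
    rw [show (1 - t) • p + t • z = p + t • (z - p) by module, smul_eq_mul, smul_eq_mul] at hconv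
    rw [show p + t • (z - p) - x₀ = (p - x₀) + t • (z - p) by module] at hle
    simp only [map_add, map_smul, inner_add_left, inner_add_right, inner_smul_left,
      inner_smul_right, hsymm, conj_trivial] at hle
    refine nonneg_of_mul_nonneg_right ?_ ht0
    linarith
  have hlim : Filter.Tendsto
      (fun t : ℝ => g z - g p + ⟪p - x₀, T (z - p)⟫ + t * (1 / 2 * ⟪z - p, T (z - p)⟫))
      (nhdsWithin 0 (Set.Ioi 0)) (nhds (g z - g p + ⟪p - x₀, T (z - p)⟫)) := by
    refine Filter.Tendsto.mono_left ?_ nhdsWithin_le_nhds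
    exact Continuous.tendsto' (by fun_prop) _ _ (by simp)
  have hnonneg := ge_of_tendsto hlim
    (Filter.eventually_of_mem (Ioo_mem_nhdsGT one_pos) hstep)
  rw [show z - x₀ = (p - x₀) + (z - p) by abel]
  simp only [map_add, inner_add_left, inner_add_right, hsymm]
  linarith

/-- Young's inequality for the quadratic form of a symmetric positive map with right inverse `S`. -/
theorem LinearMap.IsSymmetric.neg_inner_le_of_rightInverse {T S : E →ₗ[ℝ] E} (hT : T.IsSymmetric)
    (hpos : ∀ x, 0 ≤ ⟪x, T x⟫) (hTS : ∀ x, T (S x) = x) (e u : E) :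
    -⟪e, u⟫ ≤ 1 / 2 * ⟪e, S e⟫ + 1 / 2 * ⟪u, T u⟫ := by
  have h := hpos (u + S e)
  have hcross : ⟪S e, T u⟫ = ⟪e, u⟫ := by rw [← hT, hTS]
  simp only [map_add, inner_add_left, inner_add_right, hTS, hcross] at h
  linarith [real_inner_comm e u, real_inner_comm e (S e)]

end

theorem Matrix.toEuclideanLin_toEuclideanLin_inv {n : Type*} [Fintype n] [DecidableEq n]
    {H : Matrix n n ℝ} (hH : IsUnit H) (x : EuclideanSpace ℝ n) :
    Matrix.toEuclideanLin H (Matrix.toEuclideanLin H⁻¹ x) = x := by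
  simp [Matrix.toLpLin_apply,
    Matrix.mul_nonsing_inv H ((Matrix.isUnit_iff_isUnit_det H).1 hH)]

theorem Matrix.isUnit_of_sq_norm_le_inner {n : Type*} [Fintype n] [DecidableEq n]
    {H : Matrix n n ℝ}
    (h : ∀ x : EuclideanSpace ℝ n, ‖x‖ ^ 2 ≤ ⟪x, Matrix.toEuclideanLin H x⟫) : IsUnit H := by
  refine Matrix.mulVec_injective_iff_isUnit.1 ((injective_iff_map_eq_zero H.mulVecLin).2 ?_)
  intro v hv
  have hv : H *ᵥ v = 0 := hv
  have := h (WithLp.toLp 2 v)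
  rw [Matrix.toLpLin_apply, hv, WithLp.toLp_zero, inner_zero_right] at this
  have hnorm : ‖WithLp.toLp 2 v‖ = 0 :=
    (pow_eq_zero_iff two_ne_zero).1 (this.antisymm (sq_nonneg _))
  simpa using hnorm

/-- Per-iteration inequality for the QCMD adagrad update (proof of Proposition 1):
if `x₊` minimizes `x ↦ η⟨q,x⟩ + ηφ(x) + B(x,x₀)` with `B(x,y) = (1/2)(x−y)ᵀH(x−y)`,
`ψ(x) = (1/2)xᵀHx` 1-strongly convex, `f` convex with `L`-Lipschitz gradient, `φ` convex,
and `0 < η ≤ 1/(1+L)`, then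
`f(x₊)+φ(x₊)−f(x*)−φ(x*) ≤ ⟨q−∇f(x₀), x*−x₀⟩ + (1/2)(q−∇f(x₀))ᵀH⁻¹(q−∇f(x₀))
  + (1/η)[B(x*,x₀) − B(x*,x₊)]`. -/
theorem qcmd_per_iteration_inequality
    (d : ℕ) (hd : 1 ≤ d)
    (f φ : EuclideanSpace ℝ (Fin d) → ℝ)
    (gradf : EuclideanSpace ℝ (Fin d) → EuclideanSpace ℝ (Fin d))
    (L : ℝ) (hL : 0 ≤ L)
    (hfconv : ConvexOn ℝ Set.univ f)
    (hfgrad : ∀ x, HasGradientAt f (gradf x) x)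
    (hfLip : LipschitzWith (Real.toNNReal L) gradf)
    (hφconv : ConvexOn ℝ Set.univ φ)
    (H : Matrix (Fin d) (Fin d) ℝ) (hHsymm : H.IsSymm)
    (hHstrong : ∀ x : EuclideanSpace ℝ (Fin d), ‖x‖ ^ 2 ≤ ⟪x, Matrix.toEuclideanLin H x⟫)
    (η : ℝ) (hη : 0 < η) (hη2 : η ≤ 1 / (1 + L))
    (x₀ q : EuclideanSpace ℝ (Fin d))
    (B : EuclideanSpace ℝ (Fin d) → EuclideanSpace ℝ (Fin d) → ℝ)
    (hB : ∀ x y, B x y = (1 / 2) * ⟪x - y, Matrix.toEuclideanLin H (x - y)⟫)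
    (xplus : EuclideanSpace ℝ (Fin d))
    (hmin : IsMinOn (fun x => η * ⟪q, x⟫ + η * φ x + B x x₀) Set.univ xplus)
    (xstar : EuclideanSpace ℝ (Fin d)) :
    f xplus + φ xplus - f xstar - φ xstar
      ≤ ⟪q - gradf x₀, xstar - x₀⟫
        + (1 / 2) * ⟪q - gradf x₀, Matrix.toEuclideanLin H⁻¹ (q - gradf x₀)⟫
        + (1 / η) * (B xstar x₀ - B xstar xplus) := by
  have hsymm : (Matrix.toEuclideanLin H).IsSymmetric :=
    Matrix.isSymmetric_toEuclideanLin_iff.2 (Matrix.isHermitian_iff_isSymm.2 hHsymm)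
  have hgconv : ConvexOn ℝ Set.univ (fun x => η * ⟪q, x⟫ + η * φ x) :=
    (((innerₛₗ ℝ q).convexOn convex_univ).smul hη.le).add (hφconv.smul hη.le)
  have hthree := hgconv.add_inner_map_le_of_isMinOn hsymm (by simpa only [hB] using hmin) xstar
  have hdescent := hfLip.le_add_inner_gradient_add_sq hfgrad x₀ xplus
  rw [Real.coe_toNNReal L hL] at hdescent
  have hsupport := hfconv.add_inner_gradient_le (hfgrad x₀) xstar
  have hyoung := hsymm.neg_inner_le_of_rightInverse
    (fun x => (sq_nonneg ‖x‖).trans (hHstrong x))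
    (Matrix.toEuclideanLin_toEuclideanLin_inv (Matrix.isUnit_of_sq_norm_le_inner hHstrong))
    (q - gradf x₀) (xplus - x₀)
  have hstrong := hHstrong (xplus - x₀)
  have hη_inv : 1 + L ≤ 1 / η := (le_one_div hη (by positivity)).1 hη2
  rw [← hB, ← hB, ← hB] at hthree
  have hthree_div : B xplus x₀ * (1 / η) + ⟪q, xplus⟫ + φ xplus
      ≤ ⟪q, xstar⟫ + φ xstar + 1 / η * (B xstar x₀ - B xstar xplus) := by
    refine le_of_mul_le_mul_left ?_ hη
    field_simp
    linarith
  have hscale : (1 + L) * B xplus x₀ ≤ B xplus x₀ * (1 / η) := by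
    rw [mul_comm]
    refine mul_le_mul_of_nonneg_left hη_inv ?_
    rw [hB]
    linarith [sq_nonneg ‖xplus - x₀‖]
  have hLstrong := mul_le_mul_of_nonneg_left hstrong hL
  rw [hB xplus x₀] at hscale hthree_div
  simp only [inner_sub_left, inner_sub_right] at *
  linarith
end

section
/- Let d ≥ 1, λ ≥ 0, η > 0, an integer t ≥ 1, z ∈ ℝ^d, and let H, H' be symmetric positive-definite d×d matrices with H' − H positive semidefinite. Define ψ*(g; s, A) = sup_{x ∈ ℝ^d} (⟨g, x⟩ − s·λ‖x‖₁ − (1/(2η))·xᵀAx) for g ∈ ℝ^d, integer s ≥ 0, and A positive definite. Then the supremum defining ψ*(−z; t, H') is attained at a unique point x̂ ∈ ℝ^d, and ψ*(−z; t, H') ≤ ψ*(−z; t−1, H) − λ‖x̂‖₁. -/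
open Finset Matrix

section QuadraticForm

variable {n : Type*} [Fintype n]

theorem Matrix.PosDef.exists_pos_mul_norm_sq_le {A : Matrix n n ℝ} (hA : A.PosDef) :
    ∃ c : ℝ, 0 < c ∧ ∀ x : n → ℝ, c * ‖x‖ ^ 2 ≤ x ⬝ᵥ (A *ᵥ x) := by
  have hpos : ∀ x : n → ℝ, x ≠ 0 → 0 < x ⬝ᵥ (A *ᵥ x) := fun x hx => by
    simpa using hA.dotProduct_mulVec_pos hx
  have hmem : ∀ x : n → ℝ, x ≠ 0 → ‖x‖⁻¹ • x ∈ Metric.sphere (0 : n → ℝ) 1 := fun x hx => by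
    simp [norm_smul, hx]
  rcases (Metric.sphere (0 : n → ℝ) 1).eq_empty_or_nonempty with hempty | hne
  · refine ⟨1, one_pos, fun x => ?_⟩
    by_cases hx : x = 0
    · simp [hx]
    · exact absurd (hmem x hx) (hempty ▸ Set.notMem_empty _)
  · have hcont : Continuous fun x : n → ℝ => x ⬝ᵥ (A *ᵥ x) := by fun_prop
    obtain ⟨u, hu, hmin⟩ := (isCompact_sphere (0 : n → ℝ) 1).exists_isMinOn hne hcont.continuousOn
    refine ⟨u ⬝ᵥ (A *ᵥ u), hpos u (ne_zero_of_mem_unit_sphere ⟨u, hu⟩), fun x => ?_⟩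
    by_cases hx : x = 0
    · simp [hx]
    · have h := hmin (hmem x hx)
      simp only [Set.mem_ofPred_eq, mulVec_smul, dotProduct_smul, smul_dotProduct,
        smul_eq_mul] at h
      have hx' : 0 < ‖x‖ := norm_pos_iff.mpr hx
      calc u ⬝ᵥ (A *ᵥ u) * ‖x‖ ^ 2
          ≤ ‖x‖⁻¹ * (‖x‖⁻¹ * (x ⬝ᵥ (A *ᵥ x))) * ‖x‖ ^ 2 := by gcongr
        _ = x ⬝ᵥ (A *ᵥ x) := by field_simp

theorem dotProduct_le_sum_abs_mul_norm (g x : n → ℝ) : g ⬝ᵥ x ≤ (∑ i, |g i|) * ‖x‖ := by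
  rw [dotProduct, sum_mul]
  refine sum_le_sum fun i _ => (le_abs_self _).trans ?_
  rw [abs_mul]
  gcongr
  exact norm_le_pi_norm x i

/-- The parallelogram identity at the midpoint of two vectors. -/
theorem Matrix.midpoint_dotProduct_mulVec (A : Matrix n n ℝ) (x y : n → ℝ) :
    ((1 / 2 : ℝ) • (x + y)) ⬝ᵥ (A *ᵥ ((1 / 2 : ℝ) • (x + y)))
      = (x ⬝ᵥ (A *ᵥ x) + y ⬝ᵥ (A *ᵥ y)) / 2 - (x - y) ⬝ᵥ (A *ᵥ (x - y)) / 4 := by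
  simp only [mulVec_smul, mulVec_add, mulVec_sub, dotProduct_smul, smul_dotProduct,
    dotProduct_add, add_dotProduct, dotProduct_sub, sub_dotProduct, smul_eq_mul]
  ring

variable {A : Matrix n n ℝ} {μ k : ℝ}

theorem exists_isMaxOn_linear_sub_l1_sub_quadratic (hA : A.PosDef) (hμ : 0 ≤ μ) (hk : 0 < k)
    (g : n → ℝ) :
    ∃ u : n → ℝ,
      IsMaxOn (fun x : n → ℝ => g ⬝ᵥ x - μ * ∑ i, |x i| - k * (x ⬝ᵥ (A *ᵥ x))) Set.univ u := by
  obtain ⟨c, hc, hcA⟩ := hA.exists_pos_mul_norm_sq_le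
  have hcont : Continuous
      fun x : n → ℝ => g ⬝ᵥ x - μ * ∑ i, |x i| - k * (x ⬝ᵥ (A *ᵥ x)) := by fun_prop
  have hlin : Filter.Tendsto (fun r : ℝ => (∑ i, |g i|) - k * c * r)
      Filter.atTop Filter.atBot := by
    simp only [sub_eq_add_neg]
    exact Filter.tendsto_atBot_add_const_left _ _
      (Filter.tendsto_neg_atTop_atBot.comp (Filter.tendsto_id.const_mul_atTop (mul_pos hk hc)))
  have hlim := (Filter.tendsto_id.atTop_mul_atBot₀ hlin).comp
    (tendsto_norm_cocompact_atTop (E := n → ℝ))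
  have hbot := Filter.tendsto_atBot_mono (fun x : n → ℝ =>
    show g ⬝ᵥ x - μ * ∑ i, |x i| - k * (x ⬝ᵥ (A *ᵥ x))
      ≤ ‖x‖ * ((∑ i, |g i|) - k * c * ‖x‖) by
    have h1 := dotProduct_le_sum_abs_mul_norm g x
    have h2 : 0 ≤ μ * ∑ i, |x i| := by positivity
    have h3 := mul_le_mul_of_nonneg_left (hcA x) hk.le
    linarith) hlim
  obtain ⟨u, hu⟩ := hcont.exists_forall_ge hbot
  exact ⟨u, fun x _ => hu x⟩

theorem eq_of_isMaxOn_linear_sub_l1_sub_quadratic (hA : A.PosDef) (hμ : 0 ≤ μ) (hk : 0 < k)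
    {g x y : n → ℝ}
    (hx : IsMaxOn (fun x : n → ℝ => g ⬝ᵥ x - μ * ∑ i, |x i| - k * (x ⬝ᵥ (A *ᵥ x))) Set.univ x)
    (hy : IsMaxOn (fun x : n → ℝ => g ⬝ᵥ x - μ * ∑ i, |x i| - k * (x ⬝ᵥ (A *ᵥ x))) Set.univ y) :
    x = y := by
  by_contra hne
  have hpos : 0 < (x - y) ⬝ᵥ (A *ᵥ (x - y)) := by
    simpa using hA.dotProduct_mulVec_pos (sub_ne_zero.mpr hne)
  have hl1 : ∑ i, |((1 / 2 : ℝ) • (x + y)) i| ≤ (∑ i, |x i| + ∑ i, |y i|) / 2 := by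
    rw [← sum_add_distrib, sum_div]
    refine sum_le_sum fun i _ => ?_
    rw [Pi.smul_apply, Pi.add_apply, smul_eq_mul, abs_mul, abs_of_pos one_half_pos]
    linarith [abs_add_le (x i) (y i)]
  have hxm := hx (Set.mem_univ ((1 / 2 : ℝ) • (x + y)))
  have hym := hy (Set.mem_univ ((1 / 2 : ℝ) • (x + y)))
  simp only [Set.mem_ofPred_eq, midpoint_dotProduct_mulVec] at hxm hym
  rw [dotProduct_smul, dotProduct_add, smul_eq_mul] at hxm hym
  have h1 := mul_le_mul_of_nonneg_left hl1 hμ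
  have h2 := mul_pos hk hpos
  linarith

end QuadraticForm


/-- Telescoping step in the proof of Proposition 2: with `φ(x) = λ‖x‖₁`, `H ⪯ H'` symmetric
positive definite, and `ψ*(g; s, A) = sup_x (⟨g,x⟩ − sλ‖x‖₁ − (1/(2η))xᵀAx)`, the supremum
defining `ψ*(−z; t, H')` is attained at a unique `x̂`, and
`ψ*(−z; t, H') ≤ ψ*(−z; t−1, H) − λ‖x̂‖₁`. -/
theorem qrda_conjugate_telescoping
    (d : ℕ) (hd : 1 ≤ d) (lam η : ℝ) (hlam : 0 ≤ lam) (hη : 0 < η)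
    (t : ℕ) (ht : 1 ≤ t) (z : Fin d → ℝ)
    (H H' : Matrix (Fin d) (Fin d) ℝ)
    (hH : H.PosDef) (hH' : H'.PosDef) (hdiff : (H' - H).PosSemidef) :
    ∃ xhat : Fin d → ℝ,
      IsMaxOn
          (fun x : Fin d → ℝ => (-z) ⬝ᵥ x - (t : ℝ) * lam * ∑ i : Fin d, |x i|
            - (1 / (2 * η)) * (x ⬝ᵥ (H' *ᵥ x)))
          Set.univ xhat
        ∧ (∀ y : Fin d → ℝ,
            IsMaxOn
                (fun x : Fin d → ℝ => (-z) ⬝ᵥ x - (t : ℝ) * lam * ∑ i : Fin d, |x i|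
                  - (1 / (2 * η)) * (x ⬝ᵥ (H' *ᵥ x)))
                Set.univ y → y = xhat)
        ∧ ((-z) ⬝ᵥ xhat - (t : ℝ) * lam * ∑ i : Fin d, |xhat i|
              - (1 / (2 * η)) * (xhat ⬝ᵥ (H' *ᵥ xhat))
            ≤ (⨆ x : Fin d → ℝ, ((-z) ⬝ᵥ x - ((t : ℝ) - 1) * lam * ∑ i : Fin d, |x i|
                - (1 / (2 * η)) * (x ⬝ᵥ (H *ᵥ x))))
              - lam * ∑ i : Fin d, |xhat i|) := by
  have hk : 0 < 1 / (2 * η) := by positivity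
  have hμ : 0 ≤ (t : ℝ) * lam := by positivity
  have hμ' : 0 ≤ ((t : ℝ) - 1) * lam :=
    mul_nonneg (sub_nonneg.mpr (Nat.one_le_cast.mpr ht)) hlam
  obtain ⟨xhat, hmax⟩ := exists_isMaxOn_linear_sub_l1_sub_quadratic hH' hμ hk (-z)
  obtain ⟨u, hu⟩ := exists_isMaxOn_linear_sub_l1_sub_quadratic hH hμ' hk (-z)
  refine ⟨xhat, hmax, fun y hy => eq_of_isMaxOn_linear_sub_l1_sub_quadratic hH' hμ hk hy hmax, ?_⟩
  have hsup := le_ciSup (f := fun x : Fin d → ℝ => (-z) ⬝ᵥ x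
      - ((t : ℝ) - 1) * lam * ∑ i : Fin d, |x i| - (1 / (2 * η)) * (x ⬝ᵥ (H *ᵥ x)))
    ⟨_, Set.forall_mem_range.mpr fun x => hu (Set.mem_univ x)⟩ xhat
  have hquad : xhat ⬝ᵥ (H *ᵥ xhat) ≤ xhat ⬝ᵥ (H' *ᵥ xhat) := by
    have h := hdiff.dotProduct_mulVec_nonneg xhat
    rw [star_trivial, sub_mulVec, dotProduct_sub] at h
    exact sub_nonneg.mp h
  have hscaled := mul_le_mul_of_nonneg_left hquad hk.le
  linarith
end
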